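/- arXiv:2411.04988 — 2 statements merged into one kernel-verified Lean document; each statement's English description precedes it below -/
import Mathlib

section
/- For each M < ∞ there exists a finite constant C = C(M) such that the following holds. Let G = (V,E) be an amenable connected graph with all degrees at most M in which TV_n > 0. Then for each integer n ≥ 1 there exists a nonempty finite set W ⊆ V such that: (i) the diameter of W in the graph metric satisfies diam(W) ≤ min{2n, C·D_n*·log(1/TV_n)}; (ii) log|W| ≤ min{2Mn, C·(H_n* + log n)·log(1/TV_n)}; and (iii) |∂W| ≤ 4·TV_n·deg(W). -/
open scoped Classical BigOperators

namespace LazyRW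

variable {V : Type*}

/-- One-step transition kernel of the lazy simple random walk. -/
noncomputable def step (G : SimpleGraph V) [G.LocallyFinite] (x y : V) : ℝ :=
  if x = y then 1/2 else if G.Adj x y then 1 / (2 * (G.degree x)) else 0

/-- Probability of a given path of length `n` for the lazy walk started at `x`. -/
noncomputable def pathProb (G : SimpleGraph V) [G.LocallyFinite]
    (n : ℕ) (x : V) (p : Fin (n+1) → V) : ℝ :=
  (if p 0 = x then 1 else 0) * ∏ i : Fin n, step G (p i.castSucc) (p i.succ)

/-- Probability of an event determined by the first `n` steps of the lazy walk started at `x`. -/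
noncomputable def walkProb (G : SimpleGraph V) [G.LocallyFinite]
    (n : ℕ) (x : V) (E : Set (Fin (n+1) → V)) : ℝ :=
  ∑' p : (Fin (n+1) → V), pathProb G n x p * E.indicator (fun _ => (1:ℝ)) p

/-- Expectation of a functional of the first `n` steps of the lazy walk started at `x`. -/
noncomputable def walkExp (G : SimpleGraph V) [G.LocallyFinite]
    (n : ℕ) (x : V) (f : (Fin (n+1) → V) → ℝ) : ℝ :=
  ∑' p : (Fin (n+1) → V), pathProb G n x p * f p

/-- `n`-th power of the lazy transition matrix. -/
noncomputable def Pmat (G : SimpleGraph V) [G.LocallyFinite] : ℕ → V → V → ℝ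
  | 0, x, y => if x = y then 1 else 0
  | (n+1), x, y => ∑' z, Pmat G n x z * step G z y

/-- Total variation profile `TV_n`. -/
noncomputable def TV (G : SimpleGraph V) [G.LocallyFinite] (n : ℕ) : ℝ :=
  ⨆ e : {p : V × V // G.Adj p.1 p.2},
    (1/2) * ∑' z, |Pmat G n e.val.1 z - Pmat G n e.val.2 z|

/-- Expected graph-distance displacement at time `m`. -/
noncomputable def expDist (G : SimpleGraph V) [G.LocallyFinite] (m : ℕ) (x : V) : ℝ :=
  walkExp G m x (fun p => (G.dist (p 0) (p (Fin.last m)) : ℝ))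

/-- `D_n^*`: supremal expected displacement up to time `n`. -/
noncomputable def Dstar (G : SimpleGraph V) [G.LocallyFinite] (n : ℕ) : ℝ :=
  ⨆ x : V, ⨆ m : Fin (n+1), expDist G m.1 x

/-- Entropy of the walk at time `m` started at `x`. -/
noncomputable def entropy (G : SimpleGraph V) [G.LocallyFinite] (m : ℕ) (x : V) : ℝ :=
  ∑' y : V, Real.negMulLog (Pmat G m x y)

/-- `H_n^*`: supremal entropy up to time `n`. -/
noncomputable def Hstar (G : SimpleGraph V) [G.LocallyFinite] (n : ℕ) : ℝ :=
  ⨆ x : V, ⨆ m : Fin (n+1), entropy G m.1 x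

/-- `|∂W|`: the number of edges with exactly one endpoint in `W`. -/
noncomputable def boundaryCard (G : SimpleGraph V) [G.LocallyFinite] (W : Finset V) : ℕ :=
  ∑ w ∈ W, ((G.neighborFinset w).filter (fun z => z ∉ W)).card

/-- `deg(W)`: the sum of degrees of vertices in `W`. -/
noncomputable def degSum (G : SimpleGraph V) [G.LocallyFinite] (W : Finset V) : ℕ :=
  ∑ w ∈ W, G.degree w

/-- The isoperimetric profile `Φ(n)`. -/
noncomputable def isoProfile (G : SimpleGraph V) [G.LocallyFinite] (n : ℕ) : ℝ :=
  ⨅ W : {W : Finset V // W.Nonempty ∧ degSum G W ≤ n},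
    (boundaryCard G W.1 : ℝ) / (degSum G W.1 : ℝ)

/-- `q_m(u,v)`: probability that the lazy walk started at `u` first visits `v` at time `m`. -/
noncomputable def firstHit (G : SimpleGraph V) [G.LocallyFinite] (m : ℕ) (u v : V) : ℝ :=
  walkProb G m u {p | p (Fin.last m) = v ∧ ∀ i : Fin (m+1), i ≠ Fin.last m → p i ≠ v}

/-- The massive Green function `G_t(u,v)`. -/
noncomputable def greenT (G : SimpleGraph V) [G.LocallyFinite] (t : ℝ) (u v : V) : ℝ :=
  ∑' m : ℕ, (t/(t+1))^m * firstHit G m u v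


section aux
variable {V : Type*} (G : SimpleGraph V) [G.LocallyFinite]

/-- Averaging operator of the lazy walk. -/
noncomputable def T : (V → ℝ) →ₗ[ℝ] (V → ℝ) where
  toFun f x := 1/2 * f x + ∑ w ∈ G.neighborFinset x, 1 / (2 * (G.degree x : ℝ)) * f w
  map_add' f g := by
    funext x
    simp only [Pi.add_apply, mul_add, Finset.sum_add_distrib]
    ring
  map_smul' c f := by
    funext x
    simp only [Pi.smul_apply, smul_eq_mul, RingHom.id_apply, mul_add, Finset.mul_sum]
    congr 1
    · ring
    · exact Finset.sum_congr rfl fun w _ => by ring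

/-- Iterated averaging operator. -/
noncomputable def Q (m : ℕ) : (V → ℝ) →ₗ[ℝ] (V → ℝ) := (T G) ^ m

/-- point mass -/
noncomputable def dl (z : V) : V → ℝ := fun x => if x = z then 1 else 0

lemma T_apply (f : V → ℝ) (x : V) :
    T G f x = 1/2 * f x + ∑ w ∈ G.neighborFinset x, 1 / (2 * (G.degree x : ℝ)) * f w := rfl

lemma Q_zero (f : V → ℝ) : Q G 0 f = f := by simp [Q]
lemma Q_succ (m : ℕ) (f : V → ℝ) : Q G (m+1) f = T G (Q G m f) := by
  simp [Q, pow_succ']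
lemma Q_succ' (m : ℕ) (f : V → ℝ) : Q G (m+1) f = Q G m (T G f) := by
  simp [Q, pow_succ]
lemma Q_one (f : V → ℝ) : Q G 1 f = T G f := by simp [Q]
lemma Q_add (m k : ℕ) (f : V → ℝ) : Q G (m+k) f = Q G m (Q G k f) := by
  simp [Q, pow_add]

lemma T_mono {f g : V → ℝ} (h : ∀ x, f x ≤ g x) (x : V) : T G f x ≤ T G g x := by
  rw [T_apply, T_apply]
  gcongr with w hw
  · exact h x
  · exact h w

lemma Q_mono (m : ℕ) {f g : V → ℝ} (h : ∀ x, f x ≤ g x) (x : V) : Q G m f x ≤ Q G m g x := by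
  induction m generalizing x with
  | zero => simpa [Q_zero] using h x
  | succ m ih => rw [Q_succ, Q_succ]; exact T_mono G ih x

lemma T_const (hd : ∀ x, 0 < G.degree x) (c : ℝ) : T G (fun _ => c) = fun _ => c := by
  funext x
  rw [T_apply]
  have : (G.degree x : ℝ) ≠ 0 := by exact_mod_cast (hd x).ne'
  simp only [Finset.sum_const, SimpleGraph.card_neighborFinset_eq_degree, nsmul_eq_mul]
  field_simp
  ring

lemma Q_const (hd : ∀ x, 0 < G.degree x) (m : ℕ) (c : ℝ) : Q G m (fun _ => c) = fun _ => c := by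
  induction m with
  | zero => simp [Q_zero]
  | succ m ih => rw [Q_succ, ih, T_const G hd]

lemma Q_nonneg (m : ℕ) {f : V → ℝ} (h : ∀ x, 0 ≤ f x) (x : V) : 0 ≤ Q G m f x := by
  have := Q_mono G m (f := 0) (g := f) h x
  simpa using this

lemma dl_nonneg (z x : V) : 0 ≤ dl z x := by unfold dl; split_ifs <;> norm_num
lemma dl_le (z x : V) : dl z x ≤ 1 := by unfold dl; split_ifs <;> norm_num

lemma K_nonneg (m : ℕ) (z x : V) : 0 ≤ Q G m (dl z) x := Q_nonneg G m (dl_nonneg z) x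
lemma K_le (hd : ∀ x, 0 < G.degree x) (m : ℕ) (z x : V) : Q G m (dl z) x ≤ 1 := by
  have := Q_mono G m (dl_le z) x
  rwa [Q_const G hd] at this

lemma hasSum_cong {α : Type*} {f g : α → ℝ} {a : ℝ} (h : HasSum f a) (e : ∀ z, g z = f z) :
    HasSum g a := by
  rwa [show g = f from funext e]

lemma hasSum_K (m : ℕ) (f : V → ℝ) (x : V) :
    HasSum (fun z => Q G m (dl z) x * f z) (Q G m f x) := by
  induction m generalizing x with
  | zero =>
    simp only [Q_zero]
    have := hasSum_single (f := fun z => dl z x * f z) x (fun b hb => by simp [dl, hb.symm])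
    simpa [dl] using this
  | succ m ih =>
    simp only [Q_succ, T_apply]
    have h1 := (ih x).mul_left (1/2)
    have h2 := hasSum_sum (s := G.neighborFinset x)
      (fun w _ => (ih w).mul_left (1 / (2 * (G.degree x : ℝ))))
    refine hasSum_cong (h1.add h2) fun z => ?_
    rw [add_mul, Finset.sum_mul]
    congr 1
    · ring
    · exact Finset.sum_congr rfl fun w _ => by ring

lemma step_eq (x y : V) : step G x y = T G (dl y) x := by
  rw [T_apply]
  unfold step dl
  by_cases h : x = y
  · subst h
    simp
  · by_cases ha : G.Adj x y
    · simp [h, ha]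
    · simp [h, ha]

lemma Pmat_eq (m : ℕ) (x z : V) : Pmat G m x z = Q G m (dl z) x := by
  induction m generalizing z with
  | zero => simp [Pmat, Q_zero, dl]
  | succ m ih =>
    simp only [Pmat, ih, step_eq]
    rw [(hasSum_K G m (fun w => T G (dl z) w) x).tsum_eq, Q_succ']

lemma step_rev (hd : ∀ x, 0 < G.degree x) (x y : V) :
    (G.degree x : ℝ) * step G x y = G.degree y * step G y x := by
  have h1 : (G.degree x : ℝ) ≠ 0 := by exact_mod_cast (hd x).ne'
  have h2 : (G.degree y : ℝ) ≠ 0 := by exact_mod_cast (hd y).ne'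
  unfold step
  by_cases h : x = y
  · subst h; rfl
  · rw [if_neg h, if_neg (Ne.symm h)]
    by_cases ha : G.Adj x y
    · rw [if_pos ha, if_pos ha.symm]; field_simp
    · rw [if_neg ha, if_neg (fun h => ha h.symm)]; simp

lemma K_rev (hd : ∀ x, 0 < G.degree x) (m : ℕ) (x z : V) :
    (G.degree x : ℝ) * Q G m (dl z) x = G.degree z * Q G m (dl x) z := by
  induction m generalizing x z with
  | zero =>
    simp only [Q_zero, dl]
    by_cases h : x = z
    · subst h; rfl
    · simp [h, Ne.symm h]
  | succ m ih =>
    have h1 := (hasSum_K G m (T G (dl z)) x).mul_left (G.degree x : ℝ)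
    have h2 := (hasSum_K G 1 (Q G m (dl x)) z).mul_left (G.degree z : ℝ)
    rw [Q_succ', Q_succ]
    rw [Q_one] at h2
    refine h1.unique ?_
    convert h2 using 2 with w
    rw [Q_one, ← step_eq, ← step_eq, ← mul_assoc, ih, ← mul_assoc, ← step_rev G hd]
    ring

lemma K_rev_ne (hd : ∀ x, 0 < G.degree x) (m : ℕ) (x z : V) (h : Q G m (dl z) x ≠ 0) :
    Q G m (dl x) z ≠ 0 := by
  have := K_rev G hd m x z
  intro h0
  rw [h0, mul_zero] at this
  have h1 : (G.degree x : ℝ) ≠ 0 := by exact_mod_cast (hd x).ne'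
  exact (mul_ne_zero h1 h) this

lemma K_mul (m k : ℕ) (x y z : V) :
    Q G m (dl y) x * Q G k (dl z) y ≤ Q G (m+k) (dl z) x := by
  rw [Q_add]
  have : Q G m ((Q G k (dl z) y) • dl y) x ≤ Q G m (Q G k (dl z)) x := by
    apply Q_mono
    intro w
    simp only [Pi.smul_apply, smul_eq_mul, dl]
    by_cases h : w = y
    · subst h; simp
    · simp only [h, if_false, mul_zero]; exact K_nonneg G k z w
  simpa [mul_comm] using this

lemma T_ne (f : V → ℝ) (x : V) (h : T G f x ≠ 0) : f x ≠ 0 ∨ ∃ w, G.Adj x w ∧ f w ≠ 0 := by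
  by_contra hc
  push Not at hc
  apply h
  rw [T_apply, hc.1, Finset.sum_eq_zero]
  · simp
  · intro w hw
    rw [hc.2 w (by simpa using hw), mul_zero]

lemma K_dist (hc : G.Connected) (m : ℕ) (x z : V) (h : Q G m (dl z) x ≠ 0) : G.dist x z ≤ m := by
  induction m generalizing x with
  | zero =>
    simp only [Q_zero, dl] at h
    have : x = z := by by_contra h'; simp [h'] at h
    simp [this]
  | succ m ih =>
    rw [Q_succ] at h
    rcases T_ne G _ _ h with h | ⟨w, hw, h⟩
    · exact (ih x h).trans (by omega)
    · have h1 := ih w h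
      have h2 := hc.dist_triangle (u := x) (v := w) (w := z)
      have h3 := SimpleGraph.dist_eq_one_iff_adj.2 hw
      omega

lemma K_ball (M : ℕ) (hM : ∀ v, G.degree v ≤ M) (m : ℕ) (z : V) :
    ∃ B : Finset V, B.card ≤ (M+1)^m ∧ ∀ x, Q G m (dl z) x ≠ 0 → x ∈ B := by
  induction m with
  | zero =>
    refine ⟨{z}, by simp, fun x h => ?_⟩
    simp only [Q_zero, dl] at h
    have : x = z := by by_contra h'; simp [h'] at h
    simp [this]
  | succ m ih =>
    obtain ⟨B, hB, hx⟩ := ih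
    refine ⟨B.biUnion (fun w => insert w (G.neighborFinset w)), ?_, ?_⟩
    · refine (Finset.card_biUnion_le_card_mul _ _ (M+1) ?_).trans ?_
      · intro w _
        refine (Finset.card_insert_le _ _).trans ?_
        simpa using hM w
      · rw [pow_succ]; gcongr
    · intro x h
      rw [Q_succ] at h
      rw [Finset.mem_biUnion]
      rcases T_ne G _ _ h with h | ⟨w, hw, h⟩
      · exact ⟨x, hx x h, by simp⟩
      · exact ⟨w, hx w h, by simp [hw.symm]⟩
/-- indicator of being far -/
noncomputable def far (ρ : V → V → ℝ) (a : ℝ) (x : V) : V → ℝ := fun y => if a ≤ ρ x y then 1 else 0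

/-- probability of hitting the set `A` within `m` steps -/
noncomputable def hit (A : Set V) : ℕ → V → ℝ
  | 0, y => if y ∈ A then 1 else 0
  | (m+1), y => if y ∈ A then 1 else T G (hit A m) y

lemma far_nonneg (ρ : V → V → ℝ) (a : ℝ) (x y : V) : 0 ≤ far ρ a x y := by
  unfold far; split_ifs <;> norm_num

lemma far_le (ρ : V → V → ℝ) (a : ℝ) (x y : V) : far ρ a x y ≤ 1 := by
  unfold far; split_ifs <;> norm_num

lemma T_mono_nbr {f g : V → ℝ} (x : V) (h : f x ≤ g x) (h' : ∀ w, G.Adj x w → f w ≤ g w) :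
    T G f x ≤ T G g x := by
  rw [T_apply, T_apply]
  gcongr with w hw
  exact h' w (by simpa using hw)

lemma tail (hd : ∀ x, 0 < G.degree x) (ρ : V → V → ℝ) (h0 : ∀ x y, 0 ≤ ρ x y)
    (hs : ∀ x y, ρ x y = ρ y x) (ht : ∀ x y z, ρ x z ≤ ρ x y + ρ y z) (hxx : ∀ x, ρ x x = 0)
    (L D : ℝ) (hL : 0 ≤ L) (hD : 0 < D) (hadj : ∀ x y, G.Adj x y → ρ x y ≤ L) (n : ℕ)
    (hE : ∀ m ≤ n, ∀ x, Q G m (ρ x) x ≤ D) (k : ℕ) :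
    ∀ m ≤ n, ∀ x, Q G m (far ρ (k * (6 * D + L)) x) x ≤ (1/2)^k := by
  have markov : ∀ a : ℝ, 0 < a → ∀ m ≤ n, ∀ x, Q G m (far ρ a x) x ≤ D / a := by
    intro a ha m hm x
    have h1 : Q G m (far ρ a x) x ≤ Q G m ((1/a) • ρ x) x := by
      apply Q_mono
      intro y
      simp only [Pi.smul_apply, smul_eq_mul, far]
      split_ifs with h
      · rw [one_div, ← div_eq_inv_mul, le_div_iff₀ ha]; simpa using h
      · have := h0 x y; positivity
    rw [map_smul, Pi.smul_apply, smul_eq_mul] at h1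
    refine h1.trans ?_
    have := hE m hm x
    rw [one_div, ← div_eq_inv_mul]
    gcongr
  have hit1 : ∀ x, ∀ m ≤ n, ∀ y,
      hit G {y | 6 * D ≤ ρ x y} m y ≤ 2 * Q G m (far ρ (4 * D) x) y := by
    intro x
    have key : ∀ m ≤ n, ∀ y, 6 * D ≤ ρ x y → 1 ≤ 2 * Q G m (far ρ (4 * D) x) y := by
      intro m hm y hy
      have h1 : Q G m (fun _ => 1) y ≤ Q G m (far ρ (4*D) x + far ρ (2*D) y) y := by
        apply Q_mono
        intro w
        simp only [Pi.add_apply]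
        by_cases h : 4 * D ≤ ρ x w
        · have := far_nonneg ρ (2*D) y w
          simp only [far, h, if_true] at *; linarith
        · have h2 := ht x w y
          rw [hs w y] at h2
          have h3 : 2 * D ≤ ρ y w := by linarith
          simp [far, h, h3]
      rw [Q_const G hd, map_add, Pi.add_apply] at h1
      have h2 := markov (2*D) (by positivity) m hm y
      have h3 : D / (2 * D) = 1/2 := by field_simp
      linarith
    intro m
    induction m with
    | zero =>
      intro hm y
      simp only [hit, Set.mem_ofPred_eq]
      split_ifs with h
      · exact key 0 hm y h
      · have := Q_nonneg G 0 (far_nonneg ρ (4*D) x) y; positivity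
    | succ m ih =>
      intro hm y
      simp only [hit, Set.mem_ofPred_eq]
      split_ifs with h
      · exact key _ hm y h
      · have h1 := T_mono G (f := hit G {y | 6 * D ≤ ρ x y} m)
          (g := (2:ℝ) • Q G m (far ρ (4 * D) x)) (fun w => by
            simpa using ih (by omega) w) y
        rw [map_smul, Pi.smul_apply, smul_eq_mul, ← Q_succ] at h1
        exact h1
  have hit2 : ∀ m ≤ n, ∀ x, hit G {y | 6 * D ≤ ρ x y} m x ≤ 1/2 := by
    intro m hm x
    have h1 := hit1 x m hm x
    have h2 := markov (4*D) (by positivity) m hm x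
    have h3 : D / (4 * D) = 1/4 := by field_simp
    linarith
  induction k with
  | zero =>
    intro m hm x
    have := Q_mono G m (far_le ρ ((0:ℕ) * (6 * D + L)) x) x
    rw [Q_const G hd] at this
    simpa using this
  | succ k ih =>
    intro m hm x
    have main : ∀ m ≤ n, ∀ y, ρ x y ≤ 6 * D + L →
        Q G m (far ρ ((k+1 : ℕ) * (6 * D + L)) x) y ≤
          (1/2)^k * hit G {y | 6 * D ≤ ρ x y} m y := by
      have key : ∀ m ≤ n, ∀ y, ρ x y ≤ 6 * D + L →
          Q G m (far ρ ((k+1 : ℕ) * (6 * D + L)) x) y ≤ (1/2)^k := by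
        intro m hm y hy
        refine le_trans (Q_mono G m ?_ y) (ih m hm y)
        intro w
        unfold far
        split_ifs with h1 h2 <;> norm_num
        apply h2
        have := ht x y w
        push_cast at h1
        linarith
      intro m
      induction m with
      | zero =>
        intro hm y hy
        simp only [hit, Set.mem_ofPred_eq]
        split_ifs with h
        · rw [mul_one]; exact key 0 hm y hy
        · rw [Q_zero]
          have h2 : ¬ ((k+1 : ℕ) * (6 * D + L) ≤ ρ x y) := by
            push_cast
            have : (0:ℝ) ≤ k := by positivity
            nlinarith
          unfold far; rw [if_neg h2]; simp
      | succ m ihm =>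
        intro hm y hy
        simp only [hit, Set.mem_ofPred_eq]
        split_ifs with h
        · rw [mul_one]; exact key _ hm y hy
        · rw [Q_succ]
          have h1 := T_mono_nbr G (f := Q G m (far ρ ((k+1 : ℕ) * (6 * D + L)) x))
            (g := ((1/2:ℝ)^k) • hit G {y | 6 * D ≤ ρ x y} m) y
            (by simpa using ihm (by omega) y hy)
            (fun w hw => by
              have h2 := ht x y w
              have h3 := hadj y w hw
              simpa using ihm (by omega) w (by linarith))
          rw [map_smul, Pi.smul_apply, smul_eq_mul] at h1
          exact h1
    have h1 := main m hm x (by rw [hxx]; positivity)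
    have h2 := hit2 m hm x
    rw [pow_succ]
    refine h1.trans ?_
    gcongr
lemma coarea (c : ℝ) (S : Finset V)
    (hS : ∀ W ⊆ S, W.Nonempty → c * (degSum G W : ℝ) ≤ boundaryCard G W)
    (f : V → ℝ) (h0 : ∀ x, 0 ≤ f x) (hf : ∀ x, f x ≠ 0 → x ∈ S) :
    c * ∑ x ∈ S, (G.degree x : ℝ) * f x ≤
      ∑ x ∈ S, ∑ y ∈ G.neighborFinset x, max (f x - f y) 0 := by
  induction S using Finset.strongInduction generalizing f with
  | H S ih =>
    rcases S.eq_empty_or_nonempty with rfl | hne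
    · simp
    obtain ⟨a, haS, hamin⟩ := Finset.exists_min_image S f hne
    set g : V → ℝ := fun x => if x ∈ S then f x - f a else 0 with hg
    have hfo : ∀ x, x ∉ S → f x = 0 := fun x hx => by
      by_contra h; exact hx (hf x h)
    have hss : S.erase a ⊂ S := Finset.erase_ssubset haS
    have h1 := ih (S.erase a) hss (fun W hW => hS W (hW.trans hss.subset)) g
      (fun x => by
        simp only [hg]; split_ifs with h
        · linarith [hamin x h]
        · rfl)
      (fun x hx => by
        simp only [hg] at hx
        split_ifs at hx with h
        · rw [Finset.mem_erase]
          refine ⟨?_, h⟩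
          rintro rfl; simp at hx
        · exact absurd rfl hx)
    have hga : g a = 0 := by simp [hg]
    have hg0 : ∀ x, 0 ≤ g x := fun x => by
        simp only [hg]; split_ifs with h
        · linarith [hamin x h]
        · rfl
    have e1 : ∑ x ∈ S.erase a, (G.degree x : ℝ) * g x = ∑ x ∈ S, (G.degree x : ℝ) * g x := by
      rw [← Finset.sum_erase_add S _ haS, hga]; simp
    have e2 : ∑ x ∈ S.erase a, ∑ y ∈ G.neighborFinset x, max (g x - g y) 0 =
        ∑ x ∈ S, ∑ y ∈ G.neighborFinset x, max (g x - g y) 0 := by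
      rw [← Finset.sum_erase_add S _ haS, hga]
      rw [Finset.sum_eq_zero (s := G.neighborFinset a), add_zero]
      intro y _
      rw [max_eq_right]; linarith [hg0 y]
    rw [e1, e2] at h1
    have h2 := hS S (Finset.Subset.refl _) hne
    have e3 : ∑ x ∈ S, (G.degree x : ℝ) * f x =
        ∑ x ∈ S, (G.degree x : ℝ) * g x + f a * (degSum G S : ℝ) := by
      unfold degSum
      rw [Nat.cast_sum, Finset.mul_sum, ← Finset.sum_add_distrib]
      refine Finset.sum_congr rfl fun x hx => ?_
      simp only [hg, hx, if_true]; ring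
    have e4 : ∑ x ∈ S, ∑ y ∈ G.neighborFinset x, max (f x - f y) 0 =
        ∑ x ∈ S, ∑ y ∈ G.neighborFinset x, max (g x - g y) 0 + f a * (boundaryCard G S : ℝ) := by
      unfold boundaryCard
      rw [Nat.cast_sum, Finset.mul_sum, ← Finset.sum_add_distrib]
      refine Finset.sum_congr rfl fun x hx => ?_
      rw [Finset.card_filter, Nat.cast_sum, Finset.mul_sum, ← Finset.sum_add_distrib]
      refine Finset.sum_congr rfl fun y _ => ?_
      by_cases hy : y ∈ S
      · simp [hg, hx, hy]
      · have := hamin x hx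
        simp only [hg, hx, hy, if_true, if_false, hfo y hy, not_false_eq_true]
        rw [max_eq_left, max_eq_left] 
        · push_cast; ring
        · linarith
        · linarith [h0 x]
    rw [e3, e4]
    nlinarith [h0 a, mul_le_mul_of_nonneg_left h2 (h0 a)]

lemma hasSum_path (m : ℕ) (x : V) (g : V → ℝ) :
    HasSum (fun p : Fin (m+1) → V => pathProb G m x p * g (p (Fin.last m))) (Q G m g x) := by
  induction m generalizing x with
  | zero =>
    rw [Q_zero]
    have := hasSum_single (f := fun p : Fin (0+1) → V => pathProb G 0 x p * g (p (Fin.last 0)))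
      (fun _ => x) (fun p hp => by
        have : p 0 ≠ x := fun h => hp (by
          funext i; rw [show i = 0 from Fin.fin_one_eq_zero i, h])
        simp [pathProb, this])
    simpa [pathProb] using this
  | succ m ih =>
    have hinj : Function.Injective (fun q : Fin (m+1) → V => (Fin.cons x q : Fin (m+2) → V)) :=
      Fin.cons_right_injective (α := fun _ => V) x
    rw [← hinj.hasSum_iff]
    · rw [Q_succ, T_apply]
      have h1 := (ih x).mul_left (1/2)
      have h2 := hasSum_sum (s := G.neighborFinset x)
        (fun w _ => (ih w).mul_left (1 / (2 * (G.degree x : ℝ))))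
      refine hasSum_cong (h1.add h2) fun q => ?_
      simp only [Function.comp, pathProb]
      rw [Fin.prod_univ_succ]
      have e : (Fin.cons x q : Fin (m+2) → V) (Fin.last (m+1)) = q (Fin.last m) := by
        rw [← Fin.succ_last, Fin.cons_succ]
      rw [e]
      simp only [Fin.castSucc_zero, Fin.cons_zero, Fin.cons_succ, ← Fin.succ_castSucc, if_true, step_eq G x, T_apply]
      simp only [dl]
      rw [add_mul, mul_add, add_mul, Finset.sum_mul, Finset.mul_sum, Finset.sum_mul]
      congr 1
      · by_cases h : x = q 0
        · simp [h]; ring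
        · simp [h, Ne.symm h]
      · refine Finset.sum_congr rfl fun w _ => ?_
        by_cases h : w = q 0
        · simp [h]; ring
        · simp [h, Ne.symm h]
    · intro p hp
      have : p 0 ≠ x := fun h => hp ⟨Fin.tail p, by
        simp only; rw [← h]; exact Fin.cons_self_tail p⟩
      simp [pathProb, this]

lemma expDist_eq (m : ℕ) (x : V) : expDist G m x = Q G m (fun y => (G.dist x y : ℝ)) x := by
  unfold expDist walkExp
  rw [← (hasSum_path G m x (fun y => (G.dist x y : ℝ))).tsum_eq]
  refine tsum_congr fun p => ?_
  by_cases h : p 0 = x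
  · simp only [h]
  · simp [pathProb, h]

lemma Q_dist_le (hd : ∀ x, 0 < G.degree x) (hc : G.Connected) (m : ℕ) (x : V) :
    Q G m (fun y => (G.dist x y : ℝ)) x ≤ m := by
  have h1 := hasSum_K G m (fun y => (G.dist x y : ℝ)) x
  have h2 := hasSum_K G m (fun y => (m : ℝ)) x
  rw [Q_const G hd] at h2
  refine hasSum_le (fun z => ?_) h1 h2
  by_cases h : Q G m (dl z) x = 0
  · simp [h]
  · have := K_dist G hc m x z h
    have h3 := K_nonneg G m z x
    gcongr

lemma le_Dstar (hd : ∀ x, 0 < G.degree x) (hc : G.Connected) (n m : ℕ) (hm : m ≤ n) (x : V) :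
    Q G m (fun y => (G.dist x y : ℝ)) x ≤ Dstar G n := by
  unfold Dstar
  have : Nonempty V := ⟨x⟩
  rw [← expDist_eq]
  have hb : ∀ (x : V) (m : Fin (n+1)), expDist G m.1 x ≤ n := fun x m => by
    rw [expDist_eq]
    refine (Q_dist_le G hd hc _ x).trans ?_
    have := m.2
    exact_mod_cast (by omega : m.1 ≤ n)
  refine le_trans ?_ (le_ciSup (f := fun x : V => ⨆ m : Fin (n+1), expDist G m.1 x)
    ⟨n, by rintro _ ⟨y, rfl⟩; exact ciSup_le (hb y)⟩ x)
  exact le_ciSup (f := fun m : Fin (n+1) => expDist G m.1 x)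
    ⟨n, by rintro _ ⟨y, rfl⟩; exact hb x y⟩ ⟨m, by omega⟩

lemma Dstar_ge (hd : ∀ x, 0 < G.degree x) (hc : G.Connected) (n : ℕ) (hn : 1 ≤ n) (x : V) :
    1/2 ≤ Dstar G n := by
  refine le_trans ?_ (le_Dstar G hd hc n 1 hn x)
  rw [Q_one, T_apply, Finset.sum_congr rfl (g := fun _ => 1 / (2 * (G.degree x : ℝ)))]
  · have : (G.degree x : ℝ) ≠ 0 := by exact_mod_cast (hd x).ne'
    simp
    field_simp
    rfl
  · intro w hw
    rw [SimpleGraph.dist_eq_one_iff_adj.2 (by simpa using hw)]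
    simp

lemma hasSum_entropy (hd : ∀ x, 0 < G.degree x) (M : ℕ) (hM : ∀ v, G.degree v ≤ M) (m : ℕ) (x : V) :
    HasSum (fun y => Real.negMulLog (Q G m (dl y) x)) (entropy G m x) ∧
      entropy G m x ≤ (M+1 : ℝ)^m := by
  obtain ⟨B, hB, hx⟩ := K_ball G M hM m x
  have hz : ∀ y ∉ B, Real.negMulLog (Q G m (dl y) x) = 0 := by
    intro y hy
    have : Q G m (dl y) x = 0 := by
      by_contra h
      exact hy (hx y (K_rev_ne G hd m x y h))
    simp [this]
  have h1 : HasSum (fun y => Real.negMulLog (Q G m (dl y) x)) _ :=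
    hasSum_sum_of_ne_finset_zero hz
  have e : entropy G m x = ∑ y ∈ B, Real.negMulLog (Q G m (dl y) x) := by
    unfold entropy
    simp only [Pmat_eq]
    exact h1.tsum_eq
  refine ⟨e ▸ h1, ?_⟩
  rw [e]
  refine (Finset.sum_le_card_nsmul B _ 1 ?_).trans ?_
  · intro y _
    have h0 := K_nonneg G m y x
    have := Real.negMulLog_le_one_sub_self h0
    linarith
  · simp; exact_mod_cast hB

lemma le_Hstar (hd : ∀ x, 0 < G.degree x) (M : ℕ) (hM : ∀ v, G.degree v ≤ M) (n m : ℕ) (hm : m ≤ n)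
    (x : V) : entropy G m x ≤ Hstar G n := by
  unfold Hstar
  have : Nonempty V := ⟨x⟩
  have hb : ∀ (x : V) (m : Fin (n+1)), entropy G m.1 x ≤ (M+1 : ℝ)^n := fun x m => by
    refine (hasSum_entropy G hd M hM _ x).2.trans ?_
    have := m.2
    exact pow_le_pow_right₀ (by linarith [(Nat.cast_nonneg M : (0:ℝ) ≤ M)]) (by omega)
  refine le_trans ?_ (le_ciSup (f := fun x : V => ⨆ m : Fin (n+1), entropy G m.1 x)
    ⟨(M+1 : ℝ)^n, by rintro _ ⟨y, rfl⟩; exact ciSup_le (hb y)⟩ x)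
  exact le_ciSup (f := fun m : Fin (n+1) => entropy G m.1 x)
    ⟨(M+1 : ℝ)^n, by rintro _ ⟨y, rfl⟩; exact hb x y⟩ ⟨m, by omega⟩

lemma Hstar_ge (hd : ∀ x, 0 < G.degree x) (M : ℕ) (hM : ∀ v, G.degree v ≤ M) (n : ℕ) (hn : 1 ≤ n)
    (x : V) : 1/2 * Real.log 2 ≤ Hstar G n := by
  refine le_trans ?_ (le_Hstar G hd M hM n 1 hn x)
  have h1 := (hasSum_entropy G hd M hM 1 x).1
  have h2 := le_hasSum h1 x (fun y _ => Real.negMulLog_nonneg (K_nonneg G 1 y x) (K_le G hd 1 y x))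
  refine le_trans (le_of_eq ?_) h2
  rw [Q_one, ← step_eq]
  simp [step, Real.negMulLog]
/-- discounted maximal kernel -/
noncomputable def gr (l : ℝ) (u v : V) : ℝ := ⨆ m : ℕ, l^m * Q G m (dl v) u

/-- Green-type metric -/
noncomputable def rho (l : ℝ) (u v : V) : ℝ :=
  - Real.log (gr G l u v) + 1/2 * (Real.log (G.degree v) - Real.log (G.degree u))

section gr
variable (hd : ∀ x, 0 < G.degree x) {l : ℝ} (hl0 : 0 < l) (hl1 : l < 1)

lemma gr_term_le (hd : ∀ x, 0 < G.degree x) {l : ℝ} (hl0 : 0 < l) (hl1 : l < 1) (u v : V) (m : ℕ) :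
    l^m * Q G m (dl v) u ≤ 1 := by
  have h1 := K_le G hd m v u
  have h2 := K_nonneg G m v u
  have h3 : l^m ≤ 1 := pow_le_one₀ hl0.le hl1.le
  exact mul_le_one₀ h3 h2 h1

lemma le_gr (hd : ∀ x, 0 < G.degree x) {l : ℝ} (hl0 : 0 < l) (hl1 : l < 1) (u v : V) (m : ℕ) :
    l^m * Q G m (dl v) u ≤ gr G l u v :=
  le_ciSup (f := fun m : ℕ => l^m * Q G m (dl v) u)
    ⟨1, by rintro _ ⟨m, rfl⟩; exact gr_term_le G hd hl0 hl1 u v m⟩ m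

lemma gr_le (hd : ∀ x, 0 < G.degree x) {l : ℝ} (hl0 : 0 < l) (hl1 : l < 1) (u v : V) :
    gr G l u v ≤ 1 := ciSup_le (gr_term_le G hd hl0 hl1 u v)

lemma K_pos (hd : ∀ x, 0 < G.degree x) {u v : V} (p : G.Walk u v) : ∃ m, 0 < Q G m (dl v) u := by
  induction p with
  | nil => exact ⟨0, by simp [Q_zero, dl]⟩
  | @cons u w v h p ih =>
    obtain ⟨m, hm⟩ := ih
    refine ⟨m+1, ?_⟩
    rw [Q_succ, T_apply]
    have h1 : (0:ℝ) < G.degree u := by exact_mod_cast hd u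
    have h2 := K_nonneg G m v u
    have h3 : 0 < ∑ w ∈ G.neighborFinset u, 1 / (2 * (G.degree u : ℝ)) * (Q G m) (dl v) w :=
      Finset.sum_pos' (fun i _ => by have := K_nonneg G m v i; positivity)
        ⟨w, by simpa using h, by positivity⟩
    linarith

lemma gr_pos (hd : ∀ x, 0 < G.degree x) {l : ℝ} (hl0 : 0 < l) (hl1 : l < 1) (hc : G.Connected) (u v : V) :
    0 < gr G l u v := by
  obtain ⟨p⟩ := hc.preconnected u v
  obtain ⟨m, hm⟩ := K_pos G hd p
  exact lt_of_lt_of_le (by positivity) (le_gr G hd hl0 hl1 u v m)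

lemma gr_mul (hd : ∀ x, 0 < G.degree x) {l : ℝ} (hl0 : 0 < l) (hl1 : l < 1) (hc : G.Connected) (u v w : V) :
    gr G l u v * gr G l v w ≤ gr G l u w := by
  have h1 := (gr_pos G hd hl0 hl1 hc v w)
  have key : ∀ m k : ℕ, (l^m * Q G m (dl v) u) * (l^k * Q G k (dl w) v) ≤ gr G l u w := by
    intro m k
    refine le_trans ?_ (le_gr G hd hl0 hl1 u w (m+k))
    have := K_mul G m k u v w
    calc _ = l^(m+k) * (Q G m (dl v) u * Q G k (dl w) v) := by rw [pow_add]; ring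
      _ ≤ _ := by gcongr
  rw [gr, Real.iSup_mul_of_nonneg h1.le]
  refine ciSup_le fun m => ?_
  rw [gr, Real.mul_iSup_of_nonneg (by have := K_nonneg G m v u; positivity)]
  exact ciSup_le fun k => key m k

lemma gr_symm (hd : ∀ x, 0 < G.degree x) {l : ℝ} (u v : V) :
    (G.degree u : ℝ) * gr G l u v = G.degree v * gr G l v u := by
  unfold gr
  rw [Real.mul_iSup_of_nonneg (by positivity), Real.mul_iSup_of_nonneg (by positivity)]
  congr 1
  funext m
  have := K_rev G hd m u v
  linear_combination l^m * this

lemma rho_symm (hd : ∀ x, 0 < G.degree x) {l : ℝ} (hl0 : 0 < l) (hl1 : l < 1) (hc : G.Connected) (u v : V) :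
    rho G l u v = rho G l v u := by
  have h := congrArg Real.log (gr_symm G hd (l := l) u v)
  have hu : (G.degree u : ℝ) ≠ 0 := by exact_mod_cast (hd u).ne'
  have hv : (G.degree v : ℝ) ≠ 0 := by exact_mod_cast (hd v).ne'
  rw [Real.log_mul hu (gr_pos G hd hl0 hl1 hc u v).ne',
    Real.log_mul hv (gr_pos G hd hl0 hl1 hc v u).ne'] at h
  unfold rho
  linarith

lemma rho_nonneg (hd : ∀ x, 0 < G.degree x) {l : ℝ} (hl0 : 0 < l) (hl1 : l < 1) (hc : G.Connected) (u v : V) :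
    0 ≤ rho G l u v := by
  have h := rho_symm G hd hl0 hl1 hc u v
  have h1 := Real.log_nonpos (gr_pos G hd hl0 hl1 hc u v).le (gr_le G hd hl0 hl1 u v)
  have h2 := Real.log_nonpos (gr_pos G hd hl0 hl1 hc v u).le (gr_le G hd hl0 hl1 v u)
  unfold rho at *
  linarith

lemma rho_tri (hd : ∀ x, 0 < G.degree x) {l : ℝ} (hl0 : 0 < l) (hl1 : l < 1) (hc : G.Connected) (u v w : V) :
    rho G l u w ≤ rho G l u v + rho G l v w := by
  have a := gr_pos G hd hl0 hl1 hc u v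
  have b := gr_pos G hd hl0 hl1 hc v w
  have h := Real.log_le_log (mul_pos a b) (gr_mul G hd hl0 hl1 hc u v w)
  rw [Real.log_mul a.ne' b.ne'] at h
  unfold rho
  linarith

lemma rho_self (hd : ∀ x, 0 < G.degree x) {l : ℝ} (hl0 : 0 < l) (hl1 : l < 1) (u : V) :
    rho G l u u = 0 := by
  have : gr G l u u = 1 := by
    apply le_antisymm (gr_le G hd hl0 hl1 u u)
    have := le_gr G hd hl0 hl1 u u 0
    simpa [Q_zero, dl] using this
  simp [rho, this]

lemma log_deg (hd : ∀ x, 0 < G.degree x) (M : ℕ) (hM : ∀ v, G.degree v ≤ M) (x : V) :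
    0 ≤ Real.log (G.degree x) ∧ Real.log (G.degree x) ≤ Real.log M := by
  have h1 : (1:ℝ) ≤ G.degree x := by exact_mod_cast (hd x)
  refine ⟨Real.log_nonneg h1, Real.log_le_log (by linarith) (by exact_mod_cast hM x)⟩

lemma rho_adj (hd : ∀ x, 0 < G.degree x) {l : ℝ} (hl0 : 1/2 ≤ l) (hl1 : l < 1) (M : ℕ)
    (hM : ∀ v, G.degree v ≤ M) (u v : V) (h : G.Adj u v) :
    rho G l u v ≤ Real.log 4 + 2 * Real.log M := by
  have h1 := le_gr G hd (by linarith) hl1 u v 1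
  have hu : (0:ℝ) < G.degree u := by exact_mod_cast hd u
  rw [Q_one, ← step_eq, step, if_neg h.ne, if_pos h, pow_one] at h1
  have h2 : 1 / (4 * (G.degree u : ℝ)) ≤ gr G l u v := by
    refine le_trans ?_ h1
    calc 1 / (4 * (G.degree u : ℝ)) = 1/2 * (1 / (2 * (G.degree u : ℝ))) := by field_simp; norm_num
      _ ≤ _ := by gcongr
  have h3 := Real.log_le_log (by positivity) h2
  rw [one_div, Real.log_inv, Real.log_mul (by norm_num) hu.ne'] at h3
  have h4 := log_deg G hd M hM u
  have h5 := log_deg G hd M hM v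
  unfold rho
  linarith

lemma rho_exp (hd : ∀ x, 0 < G.degree x) (hc : G.Connected) (M : ℕ)
    (hM : ∀ v, G.degree v ≤ M) (n : ℕ) (hn : 1 ≤ n) (m : ℕ) (hm : m ≤ n) (x : V) :
    Q G m (rho G ((n:ℝ)/(n+1)) x) x ≤ Hstar G n + (1 + Real.log M) := by
  have hn0 : (0:ℝ) < n := by exact_mod_cast hn
  set l : ℝ := (n:ℝ)/(n+1) with hl
  have hl0 : 0 < l := by positivity
  have hl1 : l < 1 := by rw [hl, div_lt_one (by positivity)]; linarith
  have h1 := hasSum_K G m (rho G l x) x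
  have h2 := hasSum_K G m (fun _ => 1 + Real.log M) x
  rw [Q_const G hd] at h2
  have h3 := (hasSum_entropy G hd M hM m x).1
  have h4 := le_Hstar G hd M hM n m hm x
  refine le_trans (hasSum_le (fun z => ?_) h1 (h3.add h2)) (by linarith)
  rcases (K_nonneg G m z x).eq_or_lt with h | h
  · simp [← h]
  · have h5 := Real.log_le_log (by positivity) (le_gr G hd hl0 hl1 x z m)
    rw [Real.log_mul (by positivity) h.ne', Real.log_pow] at h5
    have h6 : -1 ≤ (m:ℝ) * Real.log l := by
      have h7 : Real.log l⁻¹ ≤ 1 / n := by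
        refine (Real.log_le_sub_one_of_pos (by positivity)).trans (le_of_eq ?_)
        rw [hl]; field_simp; ring
      rw [Real.log_inv] at h7
      have hm' : (m:ℝ) ≤ n := by exact_mod_cast hm
      have h8 : (m:ℝ) * (-Real.log l) ≤ n * (1/n) := by
        have : 0 ≤ - Real.log l := by
          have := Real.log_nonpos hl0.le hl1.le; linarith
        gcongr
      have : (n:ℝ) * (1/n) = 1 := by field_simp
      linarith
    have h4 := log_deg G hd M hM x
    have h5 := log_deg G hd M hM z
    have : rho G l x z ≤ - Real.log (Q G m (dl z) x) + (1 + Real.log M) := by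
      unfold rho; linarith
    calc _ ≤ Q G m (dl z) x * (- Real.log (Q G m (dl z) x) + (1 + Real.log M)) := by gcongr
      _ = _ := by rw [Real.negMulLog]; ring

lemma rho_card (hd : ∀ x, 0 < G.degree x) (hc : G.Connected) (M : ℕ)
    (hM : ∀ v, G.degree v ≤ M) (n : ℕ) (hn : 1 ≤ n) (z : V) (R : ℝ) (S : Finset V)
    (hne : S.Nonempty) (hS : ∀ x ∈ S, rho G ((n:ℝ)/(n+1)) x z < R) :
    Real.log S.card ≤ R + 2 * Real.log M + Real.log (n+1) := by
  have hn0 : (0:ℝ) < n := by exact_mod_cast hn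
  set l : ℝ := (n:ℝ)/(n+1) with hl
  have hl0 : 0 < l := by positivity
  have hl1 : l < 1 := by rw [hl, div_lt_one (by positivity)]; linarith
  have hM0 : (0:ℝ) < M := by
    have := (hd z).trans_le (hM z); exact_mod_cast this
  have hgeo := hasSum_geometric_of_lt_one hl0.le hl1
  have h1l : (1 - l)⁻¹ = n + 1 := by
    have : 1 - l = 1/(n+1) := by rw [hl]; field_simp; ring
    rw [this]; simp
  rw [h1l] at hgeo
  have hsum : ∀ x, Summable (fun m : ℕ => l^m * Q G m (dl z) x) := fun x =>
    Summable.of_nonneg_of_le (fun m => by have := K_nonneg G m z x; positivity)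
      (fun m => by
        have := K_le G hd m z x
        have h0 : 0 ≤ l^m := by positivity
        exact mul_le_of_le_one_right h0 this) hgeo.summable
  have hsm : ∀ m, ∑ x ∈ S, Q G m (dl z) x ≤ M := by
    intro m
    have h1 := hasSum_K G m (fun _ => (1:ℝ)) z
    rw [Q_const G hd] at h1
    have h2 := sum_le_hasSum S (fun x _ => by have := K_nonneg G m x z; positivity) h1
    calc ∑ x ∈ S, Q G m (dl z) x ≤ ∑ x ∈ S, M * (Q G m (dl x) z * 1) := by
          refine Finset.sum_le_sum fun x _ => ?_
          have h3 := K_rev G hd m x z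
          have h4 : (1:ℝ) ≤ G.degree x := by exact_mod_cast hd x
          have h5 : (G.degree z : ℝ) ≤ M := by exact_mod_cast hM z
          have h6 := K_nonneg G m x z
          have h7 := K_nonneg G m z x
          nlinarith
      _ ≤ M * 1 := by rw [← Finset.mul_sum]; gcongr
      _ = M := mul_one _
  have hub : ∑ x ∈ S, gr G l x z ≤ (M:ℝ) * (n+1) := by
    have h1 : ∀ x ∈ S, gr G l x z ≤ ∑' m : ℕ, l^m * Q G m (dl z) x := fun x _ =>
      ciSup_le fun m => (hsum x).le_tsum m (fun j _ => by
        have := K_nonneg G j z x; positivity)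
    refine (Finset.sum_le_sum h1).trans ?_
    have h2 := hasSum_sum (s := S) (fun x _ => (hsum x).hasSum)
    refine hasSum_le (fun m => ?_) h2 (hgeo.mul_left (M:ℝ))
    rw [← Finset.mul_sum, mul_comm]
    have := hsm m
    gcongr
  have hlb : ∀ x ∈ S, Real.exp (-(R + Real.log M)) ≤ gr G l x z := by
    intro x hx
    have h1 := hS x hx
    have h2 := log_deg G hd M hM x
    have h3 := log_deg G hd M hM z
    rw [← Real.le_log_iff_exp_le (gr_pos G hd hl0 hl1 hc x z)]
    unfold rho at h1
    linarith
  have h1 := Finset.card_nsmul_le_sum S _ _ hlb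
  rw [nsmul_eq_mul] at h1
  have hcard : (0:ℝ) < S.card := by exact_mod_cast hne.card_pos
  have h2 := Real.log_le_log (by positivity) (h1.trans hub)
  rw [Real.log_mul hcard.ne' (Real.exp_pos _).ne', Real.log_exp,
    Real.log_mul hM0.ne' (by positivity)] at h2
  linarith
end gr
lemma TV_sum (hd : ∀ x, 0 < G.degree x) (n : ℕ) (x y : V) :
    ∃ s, HasSum (fun z => |Q G n (dl z) x - Q G n (dl z) y|) s ∧ s ≤ 2 := by
  have h1 := hasSum_K G n (fun _ => (1:ℝ)) x
  have h2 := hasSum_K G n (fun _ => (1:ℝ)) y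
  rw [Q_const G hd] at h1 h2
  have hle : ∀ z, |Q G n (dl z) x - Q G n (dl z) y| ≤ Q G n (dl z) x * 1 + Q G n (dl z) y * 1 := by
    intro z
    have := K_nonneg G n z x
    have := K_nonneg G n z y
    rw [abs_le]; constructor <;> linarith
  have h3 := Summable.of_nonneg_of_le (fun z => abs_nonneg _) hle (h1.add h2).summable
  refine ⟨_, h3.hasSum, ?_⟩
  have := hasSum_le hle h3.hasSum (h1.add h2)
  linarith

lemma TV_le (hd : ∀ x, 0 < G.degree x) (n : ℕ) (x y : V) (h : G.Adj x y) :
    ∃ s, HasSum (fun z => |Q G n (dl z) x - Q G n (dl z) y|) s ∧ s ≤ 2 * TV G n := by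
  obtain ⟨s, hs, -⟩ := TV_sum G hd n x y
  refine ⟨s, hs, ?_⟩
  have : (1/2) * s ≤ TV G n := by
    unfold TV
    simp only [Pmat_eq]
    rw [← hs.tsum_eq]
    refine le_ciSup (f := fun e : {p : V × V // G.Adj p.1 p.2} =>
      (1/2) * ∑' z, |Q G n (dl z) e.val.1 - Q G n (dl z) e.val.2|) ⟨1, ?_⟩ ⟨(x, y), h⟩
    rintro _ ⟨e, rfl⟩
    obtain ⟨s, hs, h2⟩ := TV_sum G hd n e.val.1 e.val.2
    simp only [hs.tsum_eq]
    linarith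
  linarith

lemma TV_le_one (hd : ∀ x, 0 < G.degree x) (n : ℕ) (e : {p : V × V // G.Adj p.1 p.2}) :
    TV G n ≤ 1 := by
  have : Nonempty {p : V × V // G.Adj p.1 p.2} := ⟨e⟩
  unfold TV
  refine ciSup_le fun e => ?_
  simp only [Pmat_eq]
  obtain ⟨s, hs, h2⟩ := TV_sum G hd n e.val.1 e.val.2
  rw [hs.tsum_eq]
  linarith

lemma core (hd : ∀ x, 0 < G.degree x) (n : ℕ) (t : ℝ) (ht0 : 0 < t) (ht1 : t < 1/4)
    (hTV : ∀ x y, G.Adj x y →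
      ∃ s, HasSum (fun z => |Q G n (dl z) x - Q G n (dl z) y|) s ∧ s ≤ 2 * t)
    (ham : ∀ ε : ℝ, 0 < ε → ∃ F : Finset V, F.Nonempty ∧
          (boundaryCard G F : ℝ) ≤ ε * (degSum G F : ℝ))
    (ρ₁ ρ₂ : V → V → ℝ) (L₁ L₂ R₁ R₂ : ℝ) (hL₁ : 0 ≤ L₁) (hL₂ : 0 ≤ L₂)
    (hn₁ : ∀ x y z, G.Adj x y → ρ₁ y z ≤ ρ₁ x z + L₁)
    (hn₂ : ∀ x y z, G.Adj x y → ρ₂ y z ≤ ρ₂ x z + L₂)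
    (h₁ : ∀ x, Q G n (far ρ₁ (R₁ - L₁) x) x ≤ t / 4)
    (h₂ : ∀ x, Q G n (far ρ₂ (R₂ - L₂) x) x ≤ t / 4) :
    ∃ z, ∃ W : Finset V, W.Nonempty ∧
      (∀ x ∈ W, Q G n (dl z) x ≠ 0 ∧ ρ₁ x z < R₁ ∧ ρ₂ x z < R₂) ∧
      (boundaryCard G W : ℝ) ≤ 4 * t * (degSum G W : ℝ) := by
  by_contra hcon
  have hcon' : ∀ z, ∀ W : Finset V, W.Nonempty →
      (∀ x ∈ W, Q G n (dl z) x ≠ 0 ∧ ρ₁ x z < R₁ ∧ ρ₂ x z < R₂) →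
      4 * t * (degSum G W : ℝ) ≤ boundaryCard G W := by
    intro z W hW hx
    by_contra h
    exact hcon ⟨z, W, hW, hx, (not_le.1 h).le⟩
  obtain ⟨F, hFne, hF⟩ := ham t ht0
  set K : V → V → ℝ := fun x z => Q G n (dl z) x with hK
  have hK0 : ∀ x z, 0 ≤ K x z := fun x z => K_nonneg G n z x
  set a₁ : V → V → ℝ := fun x z => far ρ₁ (R₁ - L₁) x z with ha₁
  set a₂ : V → V → ℝ := fun x z => far ρ₂ (R₂ - L₂) x z with ha₂
  set f : V → V → ℝ := fun z x => if x ∈ F ∧ ρ₁ x z < R₁ ∧ ρ₂ x z < R₂ then K x z else 0 with hf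
  have hf0 : ∀ z x, 0 ≤ f z x := fun z x => by
    simp only [hf]; split_ifs
    · exact hK0 x z
    · rfl
  have hfK : ∀ z x, f z x ≤ K x z := fun z x => by
    simp only [hf]; split_ifs
    · rfl
    · exact hK0 x z
  have hlow : ∀ z, ∀ x ∈ F, K x z * 1 - K x z * a₁ x z - K x z * a₂ x z ≤ f z x := by
    intro z x hx
    have k0 := hK0 x z
    have f1 : 0 ≤ a₁ x z := far_nonneg _ _ _ _
    have f2 : 0 ≤ a₂ x z := far_nonneg _ _ _ _
    by_cases c1 : ρ₁ x z < R₁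
    · by_cases c2 : ρ₂ x z < R₂
      · have : f z x = K x z := by simp [hf, hx, c1, c2]
        rw [this]; nlinarith [mul_nonneg k0 f1, mul_nonneg k0 f2]
      · have : a₂ x z = 1 := by
          simp only [ha₂, far]; rw [if_pos]; linarith
        rw [this]; nlinarith [mul_nonneg k0 f1, hf0 z x]
    · have : a₁ x z = 1 := by
        simp only [ha₁, far]; rw [if_pos]; linarith
      rw [this]; nlinarith [mul_nonneg k0 f2, hf0 z x]
  have hup : ∀ z, ∀ x ∈ F, ∀ y, G.Adj x y → y ∈ F →
      max (f z x - f z y) 0 ≤ 1/2 * |K x z - K y z| + 1/2 * (K x z * 1 - K y z * 1)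
        + K x z * a₁ x z + K x z * a₂ x z := by
    intro z x hx y hxy hy
    have k0 := hK0 x z
    have f1 : 0 ≤ a₁ x z := far_nonneg _ _ _ _
    have f2 : 0 ≤ a₂ x z := far_nonneg _ _ _ _
    have g1 := mul_nonneg k0 f1
    have g2 := mul_nonneg k0 f2
    have b1 := le_abs_self (K x z - K y z)
    have b2 := neg_abs_le (K x z - K y z)
    refine max_le ?_ (by linarith)
    have e1 := hfK z x
    have e2 := hf0 z y
    by_cases c1 : ρ₁ y z < R₁
    · by_cases c2 : ρ₂ y z < R₂
      · have : f z y = K y z := by simp [hf, hy, c1, c2]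
        rw [this]; linarith
      · by_cases c3 : ρ₂ x z < R₂ - L₂
        · have := hn₂ x y z hxy; linarith
        · have : a₂ x z = 1 := by
            simp only [ha₂, far]; rw [if_pos]; linarith
          rw [this]; linarith
    · have : a₁ x z = 1 := by
        have := hn₁ x y z hxy
        simp only [ha₁, far]; rw [if_pos]; linarith
      rw [this]; linarith
  -- per-z inequality
  set U : V → V → V → ℝ := fun x y z => if y ∈ F then
      1/2 * |K x z - K y z| + 1/2 * (K x z * 1 - K y z * 1)
        + K x z * a₁ x z + K x z * a₂ x z else K x z * 1 with hU
  have hz : ∀ z, 4 * t * ∑ x ∈ F, (G.degree x : ℝ) *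
      (K x z * 1 - K x z * a₁ x z - K x z * a₂ x z) ≤
      ∑ x ∈ F, ∑ y ∈ G.neighborFinset x, U x y z := by
    intro z
    set S := F.filter (fun x => f z x ≠ 0) with hS
    have hSf : ∀ x, f z x ≠ 0 → x ∈ S := by
      intro x hx
      rw [hS, Finset.mem_filter]
      refine ⟨?_, hx⟩
      by_contra h
      apply hx
      simp [hf, h]
    have hco := coarea G (4 * t) S (fun W hW hne => hcon' z W hne (fun x hx => by
      have hx' := (Finset.mem_filter.1 (hW hx)).2
      simp only [hf] at hx'
      split_ifs at hx' with h
      · exact ⟨hx', h.2⟩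
      · exact absurd rfl hx')) (f z) (hf0 z) hSf
    have e1 : ∑ x ∈ S, (G.degree x : ℝ) * f z x = ∑ x ∈ F, (G.degree x : ℝ) * f z x := by
      apply Finset.sum_subset (Finset.filter_subset _ _)
      intro x _ hx
      have : f z x = 0 := by
        by_contra h; exact hx (hSf x h)
      simp [this]
    have e2 : ∑ x ∈ S, ∑ y ∈ G.neighborFinset x, max (f z x - f z y) 0 ≤
        ∑ x ∈ F, ∑ y ∈ G.neighborFinset x, max (f z x - f z y) 0 :=
      Finset.sum_le_sum_of_subset_of_nonneg (Finset.filter_subset _ _)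
        (fun x _ _ => Finset.sum_nonneg fun y _ => le_max_right _ _)
    calc _ ≤ 4 * t * ∑ x ∈ F, (G.degree x : ℝ) * f z x := by
          gcongr with x hx
          exact hlow z x hx
      _ ≤ ∑ x ∈ F, ∑ y ∈ G.neighborFinset x, max (f z x - f z y) 0 := by
          rw [← e1]; exact hco.trans e2
      _ ≤ _ := by
          refine Finset.sum_le_sum fun x hx => Finset.sum_le_sum fun y hy => ?_
          simp only [hU]
          split_ifs with h
          · exact hup z x hx y (by simpa using hy) h
          · refine max_le ?_ ?_
            · have := hfK z x; have := hf0 z y; linarith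
            · have := hK0 x z; linarith
  -- sums
  have s1 : ∀ x, HasSum (fun z => K x z * 1) 1 := fun x => by
    have h1 := hasSum_K G n (fun _ => (1:ℝ)) x
    rwa [Q_const G hd] at h1
  have s2 : ∀ x, HasSum (fun z => K x z * a₁ x z) (Q G n (far ρ₁ (R₁ - L₁) x) x) :=
    fun x => hasSum_K G n _ x
  have s3 : ∀ x, HasSum (fun z => K x z * a₂ x z) (Q G n (far ρ₂ (R₂ - L₂) x) x) :=
    fun x => hasSum_K G n _ x
  have hlowsum := (hasSum_sum (s := F) (fun x _ =>
    (((s1 x).sub (s2 x)).sub (s3 x)).mul_left (G.degree x : ℝ))).mul_left (4 * t)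
  have hUs : ∀ x y, G.Adj x y → ∃ u, HasSum (fun z => U x y z) u ∧
      u ≤ 3/2 * t + (if y ∉ F then 1 else 0) := by
    intro x y hxy
    by_cases h : y ∈ F
    · obtain ⟨s, hs, hs2⟩ := hTV x y hxy
      refine ⟨_, hasSum_cong ((((hs.mul_left (1/2)).add (((s1 x).sub (s1 y)).mul_left (1/2))).add
        (s2 x)).add (s3 x)) (fun z => by simp only [hU, h, if_true, hK]), ?_⟩
      have := h₁ x
      have := h₂ x
      simp [h]
      linarith
    · refine ⟨1, hasSum_cong (s1 x) (fun z => by simp only [hU, h, if_false]), ?_⟩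
      simp [h]; linarith
  choose! u hu hu2 using hUs
  have hupsum := hasSum_sum (s := F) (fun x _ => hasSum_sum (s := G.neighborFinset x)
    (fun y hy => hu x y (by simpa using hy)))
  have hfin := hasSum_le hz hlowsum hupsum
  have hA : (degSum G F : ℝ) * (1 - t/2) ≤ ∑ x ∈ F, (G.degree x : ℝ) *
      (1 - Q G n (far ρ₁ (R₁ - L₁) x) x - Q G n (far ρ₂ (R₂ - L₂) x) x) := by
    rw [degSum, Nat.cast_sum, Finset.sum_mul]
    refine Finset.sum_le_sum fun x hx => mul_le_mul_of_nonneg_left ?_ (by positivity)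
    linarith [h₁ x, h₂ x]
  have hB : ∑ x ∈ F, ∑ y ∈ G.neighborFinset x, u x y ≤
      3/2 * t * (degSum G F : ℝ) + boundaryCard G F := by
    rw [degSum, boundaryCard, Nat.cast_sum, Nat.cast_sum, Finset.mul_sum, ← Finset.sum_add_distrib]
    refine Finset.sum_le_sum fun x _ => ?_
    rw [Finset.card_filter, Nat.cast_sum]
    refine (Finset.sum_le_sum (fun y hy => hu2 x y (by simpa using hy))).trans (le_of_eq ?_)
    rw [Finset.sum_add_distrib]
    simp
    ring
  have hdF : (0:ℝ) < degSum G F := by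
    obtain ⟨x, hx⟩ := hFne
    have : 0 < degSum G F := Finset.sum_pos (fun x _ => hd x) ⟨x, hx⟩
    exact_mod_cast this
  have hC : 4 * t * ((degSum G F : ℝ) * (1 - t/2)) ≤ 5/2 * t * (degSum G F : ℝ) := by
    have := mul_le_mul_of_nonneg_left hA (by positivity : 0 ≤ 4 * t)
    linarith
  nlinarith [mul_pos ht0 hdF]
end aux

/-- quantitative amenability: small-TV graphs contain sets of controlled
diameter and volume with small boundary-to-volume ratio. -/
theorem statement0 (M : ℕ) :
    ∃ C : ℝ, ∀ (V : Type) (G : SimpleGraph V) [G.LocallyFinite],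
      G.Connected →
      (∀ v : V, G.degree v ≤ M) →
      -- amenability: the infimum of boundary-to-volume ratios over nonempty finite sets is 0
      (∀ ε : ℝ, 0 < ε → ∃ F : Finset V, F.Nonempty ∧
          (boundaryCard G F : ℝ) ≤ ε * (degSum G F : ℝ)) →
      ∀ n : ℕ, 1 ≤ n → 0 < TV G n →
      ∃ W : Finset V, W.Nonempty ∧
        (∀ x ∈ W, ∀ y ∈ W,
          (G.dist x y : ℝ) ≤ min (2 * (n : ℝ)) (C * Dstar G n * Real.log (1 / TV G n))) ∧
        Real.log (W.card : ℝ)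
          ≤ min (2 * (M : ℝ) * (n : ℝ))
              (C * (Hstar G n + Real.log n) * Real.log (1 / TV G n)) ∧
        (boundaryCard G W : ℝ) ≤ 4 * TV G n * (degSum G W : ℝ) := by
  refine ⟨200 + 108 * Real.log M, ?_⟩
  intro V G _ hc hM ham n hn hTV
  have hne : Nonempty {p : V × V // G.Adj p.1 p.2} := by
    by_contra h
    rw [not_nonempty_iff] at h
    unfold TV at hTV
    rw [Real.iSup_of_isEmpty] at hTV
    exact lt_irrefl _ hTV
  obtain ⟨e⟩ := hne
  have : Nontrivial V := ⟨e.val.1, e.val.2, e.2.ne⟩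
  have hd : ∀ x, 0 < G.degree x := fun x => hc.preconnected.degree_pos_of_nontrivial x
  have x₀ : V := e.val.1
  have hTV1 := TV_le_one G hd n e
  set t := TV G n with ht
  set D := Dstar G n with hD
  set H := Hstar G n with hH
  set ℓ := Real.log (1 / t) with hℓ
  have hDge : 1/2 ≤ D := Dstar_ge G hd hc n hn x₀
  have hl2 : 0.6931471803 < Real.log 2 := Real.log_two_gt_d9
  have hl2' : Real.log 2 < 0.6931471808 := Real.log_two_lt_d9
  have hHge : 1/3 ≤ H := by
    have := Hstar_ge G hd M hM n hn x₀
    linarith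
  have hM1 : (1:ℝ) ≤ M := by
    have := (hd x₀).trans_le (hM x₀); exact_mod_cast this
  have hlM : 0 ≤ Real.log M := Real.log_nonneg hM1
  have hn1 : (1:ℝ) ≤ n := by exact_mod_cast hn
  have hln : 0 ≤ Real.log n := Real.log_nonneg hn1
  have hℓ0 : 0 ≤ ℓ := Real.log_nonneg (by rw [le_div_iff₀ hTV]; linarith)
  by_cases hbig : 1/4 ≤ t
  · refine ⟨{x₀}, by simp, ?_, ?_, ?_⟩
    · intro x hx y hy
      rw [Finset.mem_singleton] at hx hy
      subst hx; subst hy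
      rw [SimpleGraph.dist_self, Nat.cast_zero]
      exact le_min (by positivity) (by positivity)
    · rw [Finset.card_singleton, Nat.cast_one, Real.log_one]
      exact le_min (by positivity) (by positivity)
    · have h1 : boundaryCard G {x₀} ≤ degSum G {x₀} := by
        simp only [boundaryCard, degSum, Finset.sum_singleton]
        refine (Finset.card_filter_le _ _).trans ?_
        simp
      have h2 : (boundaryCard G {x₀} : ℝ) ≤ degSum G {x₀} := by exact_mod_cast h1
      have h3 : (0:ℝ) ≤ degSum G {x₀} := by positivity
      nlinarith
  · have ht4 : t < 1/4 := not_le.1 hbig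
    have hl4 : Real.log 4 = 2 * Real.log 2 := by
      rw [show (4:ℝ) = 2^2 by norm_num, Real.log_pow]; norm_num
    have hℓ4 : Real.log 4 ≤ ℓ := by
      apply Real.log_le_log (by norm_num)
      rw [le_div_iff₀ hTV]; linarith
    have hℓt : ℓ = - Real.log t := by rw [hℓ, one_div, Real.log_inv]
    obtain ⟨k, hk1, hk2⟩ : ∃ k : ℕ, (1/2:ℝ)^k ≤ t/4 ∧ (k:ℝ) ≤ 4 * ℓ := by
      refine ⟨⌈(ℓ + Real.log 4) / Real.log 2⌉₊, ?_, ?_⟩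
      · rw [← Real.log_le_log_iff (by positivity) (by positivity), Real.log_pow,
          Real.log_div hTV.ne' (by norm_num), one_div, Real.log_inv]
        have := Nat.le_ceil ((ℓ + Real.log 4) / Real.log 2)
        rw [div_le_iff₀ (by linarith)] at this
        linarith
      · have h0 : 0 ≤ (ℓ + Real.log 4) / Real.log 2 := by
          have : 0 ≤ Real.log 4 := by linarith
          positivity
        refine (Nat.ceil_lt_add_one h0).le.trans ?_
        have : (ℓ + Real.log 4) / Real.log 2 ≤ 3 * ℓ := by
          rw [div_le_iff₀ (by linarith)]; nlinarith
        linarith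
    set l : ℝ := (n:ℝ)/(n+1) with hl
    have hl0 : 0 < l := by positivity
    have hl1 : l < 1 := by rw [hl, div_lt_one (by positivity)]; linarith
    have hlh : 1/2 ≤ l := by rw [hl, div_le_div_iff₀ (by norm_num) (by positivity)]; linarith
    set D₂ : ℝ := H + (1 + Real.log M) with hD₂
    set L₂ : ℝ := Real.log 4 + 2 * Real.log M with hL₂
    have hL₂0 : 0 ≤ L₂ := by linarith
    have hsym : ∀ x y : V, (G.dist x y : ℝ) = G.dist y x := fun x y => by
      rw [SimpleGraph.dist_comm]
    have htri : ∀ x y z : V, (G.dist x z : ℝ) ≤ G.dist x y + G.dist y z := fun x y z => by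
      exact_mod_cast hc.dist_triangle
    have hadj : ∀ x y : V, G.Adj x y → (G.dist x y : ℝ) ≤ 1 := fun x y h => by
      rw [SimpleGraph.dist_eq_one_iff_adj.2 h]; simp
    have tail1 := tail G hd (fun x y => (G.dist x y : ℝ)) (fun x y => by positivity) hsym htri
      (fun x => by simp) 1 D (by norm_num) (by linarith) hadj n
      (fun m hm x => le_Dstar G hd hc n m hm x) k n le_rfl
    have tail2 := tail G hd (rho G l) (rho_nonneg G hd hl0 hl1 hc) (rho_symm G hd hl0 hl1 hc)
      (rho_tri G hd hl0 hl1 hc) (rho_self G hd hl0 hl1) L₂ D₂ hL₂0 (by linarith)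
      (rho_adj G hd hlh hl1 M hM) n
      (fun m hm x => rho_exp G hd hc M hM n hn m hm x) k n le_rfl
    obtain ⟨z, W, hWne, hW, hWb⟩ := core G hd n t hTV ht4 (TV_le G hd n) ham
      (fun x y => (G.dist x y : ℝ)) (rho G l) 1 L₂ (k * (6 * D + 1) + 1) (k * (6 * D₂ + L₂) + L₂)
      (by norm_num) hL₂0
      (fun x y z h => by
        have h1 := htri y x z
        have h2 := hadj y x h.symm
        linarith)
      (fun x y z h => by
        have h1 := rho_tri G hd hl0 hl1 hc y x z
        have h2 := rho_adj G hd hlh hl1 M hM y x h.symm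
        linarith)
      (fun x => by rw [add_sub_cancel_right]; exact (tail1 x).trans hk1)
      (fun x => by rw [add_sub_cancel_right]; exact (tail2 x).trans hk1)
    refine ⟨W, hWne, ?_, ?_, hWb⟩
    · intro x hx y hy
      obtain ⟨hx1, hx2, -⟩ := hW x hx
      obtain ⟨hy1, hy2, -⟩ := hW y hy
      have h1 := htri x z y
      rw [hsym z y] at h1
      apply le_min
      · have a1 : (G.dist x z : ℝ) ≤ n := by exact_mod_cast K_dist G hc n x z hx1
        have a2 : (G.dist y z : ℝ) ≤ n := by exact_mod_cast K_dist G hc n y z hy1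
        linarith
      · have b1 : (k:ℝ) * (6 * D + 1) ≤ 4 * ℓ * (8 * D) := by
          gcongr; linarith
        have b2 : 1 ≤ 2 * (D * ℓ) := by nlinarith
        have b3 : 0 ≤ Real.log M * (D * ℓ) := by positivity
        have b4 : 0 ≤ D * ℓ := by positivity
        have b5 : (200 + 108 * Real.log M) * D * ℓ =
          200 * (D * ℓ) + 108 * (Real.log M * (D * ℓ)) := by ring
        rw [b5]
        linarith
    · apply le_min
      · obtain ⟨B, hB, hBx⟩ := K_ball G M hM n z
        have h1 : W.card ≤ (M+1)^n :=
          (Finset.card_le_card (fun x hx => hBx x (hW x hx).1)).trans hB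
        have h2 : (W.card : ℝ) ≤ ((M:ℝ)+1)^n := by exact_mod_cast h1
        have h3 : (0:ℝ) < W.card := by exact_mod_cast hWne.card_pos
        have h4 := Real.log_le_log h3 h2
        rw [Real.log_pow] at h4
        have h5 := Real.log_le_sub_one_of_pos (by positivity : (0:ℝ) < (M:ℝ)+1)
        nlinarith
      · have h1 := rho_card G hd hc M hM n hn z _ W hWne (fun x hx => (hW x hx).2.2)
        have h2 : Real.log ((n:ℝ)+1) ≤ Real.log 2 + Real.log n := by
          rw [← Real.log_mul (by norm_num) (by positivity)]
          apply Real.log_le_log (by positivity); linarith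
        have b1 : (k:ℝ) * (6 * D₂ + L₂) ≤ 4 * ℓ * (6 * D₂ + L₂) := by
          have : 0 ≤ D₂ := by linarith
          gcongr
        have hℓ1 : 1 ≤ ℓ := by linarith
        have b2 : L₂ + 2 * Real.log M + (Real.log 2 + Real.log n) ≤
            ℓ * (L₂ + 2 * Real.log M + (Real.log 2 + Real.log n)) :=
          le_mul_of_one_le_left (by linarith) hℓ1
        have b3 : 4 * (6 * D₂ + L₂) + (L₂ + 2 * Real.log M + (Real.log 2 + Real.log n)) ≤
            (200 + 108 * Real.log M) * (H + Real.log n) := by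
          have c1 : 0 ≤ Real.log M * Real.log n := by positivity
          have c2 : Real.log M * (1/3) ≤ Real.log M * H := by gcongr
          rw [hD₂, hL₂]
          nlinarith
        have b4 := mul_le_mul_of_nonneg_left b3 hℓ0
        rw [mul_add] at b4
        have b5 : (200 + 108 * Real.log M) * (H + Real.log n) * ℓ =
          ℓ * ((200 + 108 * Real.log M) * (H + Real.log n)) := by ring
        have b6 : ℓ * (4 * (6 * D₂ + L₂)) = 4 * ℓ * (6 * D₂ + L₂) := by ring
        rw [b5]
        rw [b6] at b4
        clear_value D₂ L₂ ℓ
        linarith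

end LazyRW
end

section
/- There is a universal constant c > 0 such that the following holds. Let G = (V,E) be a connected locally finite graph with all degrees at most M, where 2 ≤ M < ∞, let d be a metric on V, and let n ≥ 1 be an integer. Then for every y ∈ V there exist x ∈ V and 0 ≤ m ≤ n such that E_x[ d(X_0,X_m) ] ≥ (c/(16·M·log M))·E_y[ max_{0≤ℓ≤n} d(X_0,X_ℓ) ]. -/
open scoped Classical BigOperators

namespace LazyRW

variable {V : Type*}

noncomputable def nbS (G : SimpleGraph V) [G.LocallyFinite] (x : V) : Finset V :=
  insert x (G.neighborFinset x)

noncomputable def av (G : SimpleGraph V) [G.LocallyFinite] (x : V) (f : V → ℝ) : ℝ :=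
  ∑ z ∈ nbS G x, step G x z * f z

theorem step_nonneg (G : SimpleGraph V) [G.LocallyFinite] (x z : V) : 0 ≤ step G x z := by
  unfold step
  split_ifs <;> positivity

theorem step_zero (G : SimpleGraph V) [G.LocallyFinite] (x z : V) (h : z ∉ nbS G x) :
    step G x z = 0 := by
  simp only [nbS, Finset.mem_insert, SimpleGraph.mem_neighborFinset, not_or] at h
  unfold step
  rw [if_neg (fun e => h.1 e.symm), if_neg h.2]

theorem av_mono (G : SimpleGraph V) [G.LocallyFinite] (x : V) (f g : V → ℝ)
    (h : ∀ z ∈ nbS G x, f z ≤ g z) : av G x f ≤ av G x g :=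
  Finset.sum_le_sum fun z hz => mul_le_mul_of_nonneg_left (h z hz) (step_nonneg G x z)

theorem av_add (G : SimpleGraph V) [G.LocallyFinite] (x : V) (f g : V → ℝ) :
    av G x (fun z => f z + g z) = av G x f + av G x g := by
  simp only [av, mul_add, Finset.sum_add_distrib]

theorem av_mul (G : SimpleGraph V) [G.LocallyFinite] (x : V) (f : V → ℝ) (c : ℝ) :
    av G x (fun z => f z * c) = av G x f * c := by
  simp only [av, ← mul_assoc, Finset.sum_mul]

theorem av_const (G : SimpleGraph V) [G.LocallyFinite] (x : V) (hx : 0 < G.degree x) (c : ℝ) :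
    av G x (fun _ => c) = c := by
  have h1 : ∑ z ∈ G.neighborFinset x, step G x z = 1/2 := by
    have : ∀ z ∈ G.neighborFinset x, step G x z = 1 / (2 * (G.degree x : ℝ)) := by
      intro z hz
      rw [SimpleGraph.mem_neighborFinset] at hz
      unfold step
      rw [if_neg hz.ne, if_pos hz]
    rw [Finset.sum_congr rfl this, Finset.sum_const, SimpleGraph.card_neighborFinset_eq_degree]
    have : (G.degree x : ℝ) ≠ 0 := by positivity
    simp
    field_simp
  have h2 : ∑ z ∈ nbS G x, step G x z = 1 := by
    unfold nbS
    rw [Finset.sum_insert (by simp), h1]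
    simp [step]
    norm_num
  unfold av
  rw [← Finset.sum_mul, h2, one_mul]

/-- recursive expectation -/
noncomputable def EE (G : SimpleGraph V) [G.LocallyFinite] :
    (k : ℕ) → V → ((Fin (k+1) → V) → ℝ) → ℝ
  | 0, x, f => f (fun _ => x)
  | (k+1), x, f => av G x (fun z => EE G k z (fun p => f (Fin.cons x p)))

theorem hasSum_EE (G : SimpleGraph V) [G.LocallyFinite] (k : ℕ) :
    ∀ (x : V) (f : (Fin (k+1) → V) → ℝ),
      HasSum (fun p => pathProb G k x p * f p) (EE G k x f) := by
  induction k with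
  | zero =>
    intro x f
    have := hasSum_single (f := fun p : Fin (0+1) → V => pathProb G 0 x p * f p) (fun _ => x) (by
      intro p hp
      have : p 0 ≠ x := by
        intro h
        apply hp
        funext i
        rw [show i = 0 from Fin.ext (by omega), h]
      simp [pathProb, this])
    simpa [pathProb, EE] using this
  | succ k ih =>
    intro x f
    have key : (fun p : Fin (k+1+1) → V => pathProb G (k+1) x p * f p) =
        fun p => ∑ z ∈ nbS G x, step G x z *
          ((if p 0 = x then 1 else 0) * (pathProb G k z (Fin.tail p) * f p)) := by
      funext p
      by_cases h : p 0 = x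
      · have e1 : pathProb G (k+1) x p = step G x (p 1) *
            ∏ i : Fin k, step G (Fin.tail p i.castSucc) (Fin.tail p i.succ) := by
          unfold pathProb
          rw [Fin.prod_univ_succ, if_pos h, one_mul]
          simp only [Fin.castSucc_zero, h]
          rfl
        have e2 : ∀ z, pathProb G k z (Fin.tail p) = (if z = p 1 then 1 else 0) *
            ∏ i : Fin k, step G (Fin.tail p i.castSucc) (Fin.tail p i.succ) := by
          intro z
          unfold pathProb
          congr 1
          have : Fin.tail p 0 = p 1 := rfl
          rw [this]
          simp only [eq_comm]
        rw [e1]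
        simp only [e2, h, if_true, one_mul]
        by_cases hm : p 1 ∈ nbS G x
        · rw [Finset.sum_eq_single_of_mem (p 1) hm]
          · simp [mul_assoc]
          · intro b _ hb
            simp [hb]
        · rw [step_zero G x _ hm]
          rw [Finset.sum_eq_zero]
          · ring
          · intro b hb
            have : b ≠ p 1 := fun e => hm (e ▸ hb)
            simp [this]
      · simp [pathProb, h]
    rw [key]
    unfold EE av
    refine hasSum_sum fun z _ => HasSum.mul_left _ ?_
    have inj : Function.Injective (fun q : Fin (k+1) → V => (Fin.cons x q : Fin (k+1+1) → V)) :=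
      fun a b h => (Fin.cons_inj.1 h).2
    rw [← inj.hasSum_iff]
    · have := ih z (fun p => f (Fin.cons x p))
      have e : (fun p : Fin (k+1+1) → V => (if p 0 = x then (1:ℝ) else 0) *
          (pathProb G k z (Fin.tail p) * f p)) ∘ (fun q : Fin (k+1) → V => Fin.cons x q) =
          fun p => pathProb G k z p * f (Fin.cons x p) := by
        funext q
        simp
      rw [e]
      exact this
    · intro p hp
      have : p 0 ≠ x := by
        intro h
        apply hp
        exact ⟨Fin.tail p, by rw [← h]; exact Fin.cons_self_tail p⟩
      simp [this]

theorem walkExp_eq (G : SimpleGraph V) [G.LocallyFinite] (k : ℕ) (x : V)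
    (f : (Fin (k+1) → V) → ℝ) : walkExp G k x f = EE G k x f :=
  (hasSum_EE G k x f).tsum_eq

theorem EE_congr (G : SimpleGraph V) [G.LocallyFinite] (k : ℕ) (x : V)
    (f g : (Fin (k+1) → V) → ℝ) (h : ∀ p, p 0 = x → f p = g p) : EE G k x f = EE G k x g := by
  cases k with
  | zero => exact h _ rfl
  | succ k =>
    unfold EE
    have : ∀ p : Fin (k+1) → V, f (Fin.cons x p) = g (Fin.cons x p) := fun p => h _ rfl
    simp only [this]

noncomputable def UU (G : SimpleGraph V) [G.LocallyFinite] (d : V → V → ℝ) (o : V) : ℕ → V → ℝ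
  | 0, x => d o x
  | (k+1), x => av G x (fun z => UU G d o k z)

theorem EE_UU (G : SimpleGraph V) [G.LocallyFinite] (d : V → V → ℝ) (o : V) (k : ℕ) :
    ∀ x, EE G k x (fun p => d o (p (Fin.last k))) = UU G d o k x := by
  induction k with
  | zero => intro x; rfl
  | succ k ih =>
    intro x
    unfold EE UU
    simp only [← ih, ← Fin.succ_last, Fin.cons_succ]

noncomputable def HH (G : SimpleGraph V) [G.LocallyFinite] (d : V → V → ℝ) (o : V) :
    ℕ → ℝ → V → ℝ
  | 0, b, x => max b (d o x)
  | (k+1), b, x => av G x (fun z => HH G d o k (max b (d o x)) z)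

theorem EE_HH (G : SimpleGraph V) [G.LocallyFinite] (d : V → V → ℝ) (o : V) (k : ℕ) :
    ∀ (x : V) (b : ℝ) (f : (Fin (k+1) → V) → ℝ),
      (∀ p c, b ≤ c → (∀ l, d o (p l) ≤ c) → f p ≤ c) → EE G k x f ≤ HH G d o k b x := by
  induction k with
  | zero => intro x b f hf; exact hf _ _ (le_max_left _ _) (fun _ => le_max_right _ _)
  | succ k ih =>
    intro x b f hf
    unfold EE HH
    refine av_mono G x _ _ fun z _ => ih z _ _ fun p c hb hp => hf _ _ ((le_max_left _ _).trans hb) ?_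
    intro l
    refine Fin.cases ?_ (fun i => ?_) l
    · exact (le_max_right _ _).trans hb
    · exact hp i

noncomputable def TT (G : SimpleGraph V) [G.LocallyFinite] (d : V → V → ℝ) (o : V) (L : ℝ) :
    ℕ → V → ℝ
  | 0, x => if L ≤ d o x then 1 else 0
  | (k+1), x => if L ≤ d o x then 1 else av G x (fun z => TT G d o L k z)

section
variable (G : SimpleGraph V) [G.LocallyFinite] (d : V → V → ℝ)

theorem UU_nonneg (dn : ∀ u v, 0 ≤ d u v) (o : V) (k : ℕ) : ∀ x, 0 ≤ UU G d o k x := by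
  induction k with
  | zero => intro x; exact dn _ _
  | succ k ih =>
    intro x
    exact Finset.sum_nonneg fun z _ => mul_nonneg (step_nonneg G x z) (ih z)

theorem UU_tri (hdeg : ∀ x, 0 < G.degree x) (ds : ∀ u v, d u v = d v u)
    (dt : ∀ u v w, d u w ≤ d u v + d v w) (o x' : V) (k : ℕ) :
    ∀ x, d o x' ≤ UU G d o k x + UU G d x' k x := by
  induction k with
  | zero => intro x; have := dt o x x'; rw [ds x x'] at this; exact this
  | succ k ih =>
    intro x
    unfold UU
    rw [← av_add, ← av_const G x (hdeg x) (d o x')]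
    exact av_mono G x _ _ fun z _ => ih z

theorem TT_le (hdeg : ∀ x, 0 < G.degree x) (dn : ∀ u v, 0 ≤ d u v) (ds : ∀ u v, d u v = d v u)
    (dt : ∀ u v w, d u w ≤ d u v + d v w) (n : ℕ) (A L : ℝ)
    (hA : ∀ k ≤ n, ∀ x, UU G d x k x ≤ A) (o : V) (k : ℕ) :
    k ≤ n → ∀ x, TT G d o L k x * (L - A) ≤ UU G d o k x := by
  induction k with
  | zero =>
    intro hk x
    have h1 := UU_tri G d hdeg ds dt o x 0 x
    have h2 := hA 0 hk x
    have h3 := UU_nonneg G d dn o 0 x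
    unfold TT
    split_ifs <;> linarith
  | succ k ih =>
    intro hk x
    have h1 := UU_tri G d hdeg ds dt o x (k+1) x
    have h2 := hA (k+1) hk x
    unfold TT
    split_ifs
    · linarith
    · rw [← av_mul]
      unfold UU
      exact av_mono G x _ _ fun z _ => ih (by omega) z

theorem HH_shift (hdeg : ∀ x, 0 < G.degree x)
    (dt : ∀ u v w, d u w ≤ d u v + d v w) (o x' : V) (a : ℝ) (ha : d o x' ≤ a) (k : ℕ) :
    ∀ (b b' : ℝ) (x : V), b ≤ a + b' → HH G d o k b x ≤ a + HH G d x' k b' x := by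
  induction k with
  | zero =>
    intro b b' x h
    unfold HH
    have := dt o x' x
    have h1 := le_max_left b' (d x' x)
    have h2 := le_max_right b' (d x' x)
    exact max_le (by linarith) (by linarith)
  | succ k ih =>
    intro b b' x h
    unfold HH
    nth_rewrite 1 [← av_const G x (hdeg x) a]
    rw [← av_add]
    refine av_mono G x _ _ fun z _ => ih _ _ z ?_
    have := dt o x' x
    have h1 := le_max_left b' (d x' x)
    have h2 := le_max_right b' (d x' x)
    exact max_le (by linarith) (by linarith)

theorem HH_le (hdeg : ∀ x, 0 < G.degree x)
    (dt : ∀ u v w, d u w ≤ d u v + d v w) (L J S : ℝ) (o : V) (hJ0 : 0 ≤ J)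
    (hJ : ∀ x, ∀ z ∈ nbS G x, d x z ≤ J) (k : ℕ) :
    (∀ j ≤ k, ∀ z, HH G d z j 0 z ≤ S) →
    ∀ x, d o x ≤ L + J → HH G d o k (L+J) x ≤ L + J + TT G d o L k x * S := by
  induction k with
  | zero =>
    intro hS x hx
    unfold HH TT
    rw [max_eq_left hx]
    split_ifs with h
    · have h1 := hS 0 le_rfl x
      unfold HH at h1
      have := le_max_left 0 (d x x)
      linarith
    · linarith
  | succ k ih =>
    intro hS x hx
    by_cases h : L ≤ d o x
    · have h1 := HH_shift G d hdeg dt o x (L+J) hx (k+1) (L+J) 0 x (by linarith)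
      have h2 := hS (k+1) le_rfl x
      unfold TT
      rw [if_pos h]
      linarith
    · unfold HH TT
      rw [if_neg h, max_eq_left hx, ← av_mul]
      nth_rewrite 2 [← av_const G x (hdeg x) (L+J)]
      rw [← av_add]
      refine av_mono G x _ _ fun z hz => ih (fun j hj => hS j (by omega)) z ?_
      have := dt o x z
      have := hJ x z hz
      linarith

theorem HH_mono (o : V) (k : ℕ) : ∀ (b b' : ℝ) (x : V), b ≤ b' →
    HH G d o k b x ≤ HH G d o k b' x := by
  induction k with
  | zero => intro b b' x h; exact max_le_max_right _ h
  | succ k ih =>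
    intro b b' x h
    exact av_mono G x _ _ fun z _ => ih _ _ z (max_le_max_right _ h)

theorem HH_main (hdeg : ∀ x, 0 < G.degree x) (dn : ∀ u v, 0 ≤ d u v)
    (d0 : ∀ u, d u u = 0) (ds : ∀ u v, d u v = d v u)
    (dt : ∀ u v w, d u w ≤ d u v + d v w) (n : ℕ) (A J : ℝ) (hA0 : 0 < A) (hJ0 : 0 ≤ J)
    (hA : ∀ k ≤ n, ∀ x, UU G d x k x ≤ A)
    (hJ : ∀ x, ∀ z ∈ nbS G x, d x z ≤ J) (k : ℕ) :
    k ≤ n → ∀ x, HH G d x k 0 x ≤ 2 * (3 * A + J) := by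
  induction k using Nat.strong_induction_on with
  | _ k ih =>
    intro hk x
    cases k with
    | zero => 
      unfold HH
      rw [d0]
      simp
      linarith
    | succ k =>
      have hT := TT_le G d hdeg dn ds dt n A (3*A) hA x (k+1) hk x
      have hU := hA (k+1) hk x
      have h3 : TT G d x (3*A) (k+1) x ≤ 1/2 := by
        by_contra hc
        push Not at hc
        nlinarith
      have hS : ∀ j ≤ k, ∀ z, HH G d z j 0 z ≤ 2 * (3*A+J) := fun j hj z =>
        ih j (by omega) (by omega) z
      have hm := HH_mono G d x (k+1) 0 (3*A+J) x (by linarith)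
      have hlt : ¬ (3 * A ≤ d x x) := by rw [d0]; linarith
      have : HH G d x (k+1) (3*A+J) x ≤ 3*A+J + TT G d x (3*A) (k+1) x * (2 * (3*A+J)) := by
        unfold HH TT
        rw [if_neg hlt, max_eq_left (by rw [d0]; linarith), ← av_mul]
        nth_rewrite 2 [← av_const G x (hdeg x) (3*A+J)]
        rw [← av_add]
        refine av_mono G x _ _ fun z hz =>
          HH_le G d hdeg dt (3*A) J _ x hJ0 hJ k hS z ?_
        have := hJ x z hz
        linarith
      nlinarith

end

/-- some point and time realize an expected displacement comparable to the
expected maximal displacement. -/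
theorem statement10 :
    ∃ c : ℝ, 0 < c ∧ ∀ (V : Type) (G : SimpleGraph V) [G.LocallyFinite],
      G.Connected →
      ∀ M : ℕ, 2 ≤ M → (∀ v : V, G.degree v ≤ M) →
      ∀ d : V → V → ℝ,
        (∀ u v : V, d u v = 0 ↔ u = v) →
        (∀ u v : V, d u v = d v u) →
        (∀ u v w : V, d u w ≤ d u v + d v w) →
      ∀ n : ℕ, 1 ≤ n →
      ∀ y : V, ∃ (x : V) (m : ℕ), m ≤ n ∧
        (c / (16 * (M : ℝ) * Real.log M))
            * walkExp G n y (fun q => ⨆ l : Fin (n+1), d (q 0) (q l))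
          ≤ walkExp G m x (fun p => d (p 0) (p (Fin.last m))) := by
  refine ⟨1, one_pos, ?_⟩
  intro V G _ hG M hM hdegM d hd0 ds dt n hn y
  have d0 : ∀ u, d u u = 0 := fun u => (hd0 u u).2 rfl
  have dn : ∀ u v, 0 ≤ d u v := by
    intro u v
    have := dt u v u
    rw [d0, ds v u] at this
    linarith
  have hend : ∀ k x, walkExp G k x (fun p => d (p 0) (p (Fin.last k))) = UU G d x k x := by
    intro k x
    rw [walkExp_eq, ← EE_UU]
    exact EE_congr G k x _ _ fun p hp => by rw [hp]
  rcases subsingleton_or_nontrivial V with hV | hV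
  · refine ⟨y, 0, Nat.zero_le _, ?_⟩
    have h1 : ∀ a b, d a b = 0 := fun a b => (hd0 a b).2 (Subsingleton.elim a b)
    simp [walkExp, h1]
  have hdeg : ∀ x, 0 < G.degree x := fun x => hG.preconnected.degree_pos_of_nontrivial x
  by_contra hcon
  push Not at hcon
  set F := walkExp G n y (fun q => ⨆ l : Fin (n+1), d (q 0) (q l)) with hF
  set A := 1 / (16 * (M : ℝ) * Real.log M) * F with hAdef
  have hA : ∀ k ≤ n, ∀ x, UU G d x k x ≤ A := by
    intro k hk x
    rw [← hend]
    exact (hcon x k hk).le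
  have hA0 : 0 < A := by
    have := hcon y 0 (Nat.zero_le _)
    rw [hend] at this
    unfold UU at this
    rwa [d0] at this
  have hM2 : (2:ℝ) ≤ M := by exact_mod_cast hM
  have hJ : ∀ x, ∀ z ∈ nbS G x, d x z ≤ 2 * M * A := by
    intro x z hz
    by_cases hxz : x = z
    · rw [← hxz, d0]; positivity
    have hadj : G.Adj x z := by
      simp only [nbS, Finset.mem_insert, SimpleGraph.mem_neighborFinset] at hz
      exact hz.resolve_left (fun e => hxz e.symm)
    have h1 : step G x z * d x z ≤ UU G d x 1 x := by
      unfold UU av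
      exact Finset.single_le_sum (f := fun z => step G x z * UU G d x 0 z)
        (fun w _ => mul_nonneg (step_nonneg G x w) (dn x w)) hz
    have h2 : step G x z = 1 / (2 * (G.degree x : ℝ)) := by
      unfold step
      rw [if_neg hxz, if_pos hadj]
    have h3 := hA 1 hn x
    have hp : (0:ℝ) < G.degree x := by exact_mod_cast hdeg x
    have hq : (G.degree x : ℝ) ≤ M := by exact_mod_cast hdegM x
    rw [h2] at h1
    have h4 : d x z = 2 * (G.degree x : ℝ) * (1 / (2 * (G.degree x : ℝ)) * d x z) := by
      field_simp
    rw [h4]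
    calc _ ≤ 2 * (G.degree x : ℝ) * A := by gcongr; linarith
      _ ≤ _ := by gcongr
  have hmain := HH_main G d hdeg dn d0 ds dt n A (2*M*A) hA0 (by positivity) hA hJ n le_rfl y
  have hFle : F ≤ HH G d y n 0 y := by
    rw [hF, walkExp_eq, EE_congr G n y _ (fun q => ⨆ l : Fin (n+1), d y (q l))
      (fun p hp => by simp only [hp])]
    exact EE_HH G d y n y 0 _ fun p c _ hc => ciSup_le hc
  have hlog : 0.69 < Real.log M := by
    have h1 := Real.log_two_gt_d9
    have h2 := Real.log_le_log (by norm_num) hM2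
    linarith
  have hAF : A * (16 * M * Real.log M) = F := by
    rw [hAdef]
    have : Real.log M ≠ 0 := by linarith
    field_simp
  have hMA : 0 < M * A := by positivity
  have : F ≤ 7 * (M * A) := by nlinarith
  have : F = 16 * (M * A) * Real.log M := by rw [← hAF]; ring
  nlinarith

end LazyRW
end
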